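/- π = 16 ∑_{p=0}^{∞} (-1)^p / ((2p+1)⁵ + 4(2p+1)); that is, the series with p-th term (-1)^p/((2p+1)⁵ + 4(2p+1)) for p ≥ 0 converges and its sum equals π/16. -/

import Mathlib

open Filter

lemma madhava_partial (n : ℕ) :
    ∑ p ∈ Finset.range n,
        (-1 : ℝ) ^ p / ((2 * (p : ℝ) + 1) ^ 5 + 4 * (2 * (p : ℝ) + 1)) =
      (1 / 4) * (∑ i ∈ Finset.range n, (-1 : ℝ) ^ i / (2 * (i : ℝ) + 1)
        + (-1 : ℝ) ^ n * ((n : ℝ) / (4 * (n : ℝ) ^ 2 + 1))) := by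
  induction n with
  | zero => simp
  | succ k ih =>
    rw [Finset.sum_range_succ, Finset.sum_range_succ, ih]
    push_cast
    have e : (2 * (k : ℝ) + 1) ^ 5 + 4 * (2 * (k : ℝ) + 1)
        = (2 * (k : ℝ) + 1) * (4 * (k : ℝ) ^ 2 + 1) * (4 * ((k : ℝ) + 1) ^ 2 + 1) := by ring
    have h1 : (2 * (k : ℝ) + 1) ≠ 0 := by positivity
    have h2 : (4 * (k : ℝ) ^ 2 + 1) ≠ 0 := by positivity
    have h3 : (4 * ((k : ℝ) + 1) ^ 2 + 1) ≠ 0 := by positivity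
    rw [e, pow_succ]
    field_simp
    ring

lemma madhava_corr_tendsto :
    Tendsto (fun n : ℕ => (-1 : ℝ) ^ n * ((n : ℝ) / (4 * (n : ℝ) ^ 2 + 1))) atTop (nhds 0) := by
  refine squeeze_zero_norm (fun n => ?_) (tendsto_one_div_add_atTop_nhds_zero_nat (𝕜 := ℝ))
  rw [norm_mul, norm_pow, norm_neg, norm_one, one_pow, one_mul,
    Real.norm_of_nonneg (by positivity), div_le_div_iff₀ (by positivity) (by positivity)]
  nlinarith [sq_nonneg ((n : ℝ) - 1), sq_nonneg (n : ℝ)]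

/-- Second accelerated Mādhava series:
`π = 16 ∑_{p=0}^∞ (-1)^p / ((2p+1)⁵ + 4(2p+1))`, i.e. the partial sums of the series
converge and its sum is `π/16`. -/
theorem madhava_accelerated_series_two :
    Tendsto
      (fun n : ℕ => ∑ p ∈ Finset.range n,
        (-1 : ℝ) ^ p / ((2 * (p : ℝ) + 1) ^ 5 + 4 * (2 * (p : ℝ) + 1)))
      atTop (nhds (Real.pi / 16)) := by
  simp_rw [madhava_partial]
  have h := (Real.tendsto_sum_pi_div_four.add madhava_corr_tendsto).const_mul (1 / 4 : ℝ)
  have e : (1 / 4 : ℝ) * (Real.pi / 4 + 0) = Real.pi / 16 := by ring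
  rw [e] at h
  exact h
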